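/- Let p > 2 be a prime and let a, b, a', b' be nonzero elements of ℤ_p ⊆ ℚ_p with a ≠ b and a' ≠ b'. Assume ab, a'b' and −aa' are squares in ℚ_p. Put l := max(ν_p(a), ν_p(b), ν_p(a−b), ν_p(a'), ν_p(b'), ν_p(a'−b')). Let (x, u, z) ∈ ℚ_p³ satisfy z ≠ 0 and z² = x(x−a)(x−b)·u(u−a')(u−b'), and suppose that ν_p(x) < 0, or ν_p(u) < 0, or there exist μ ∈ {0, a, b} and ν' ∈ {0, a', b'} with ν_p(x − μ) ≥ l+1 and ν_p(u − ν') ≥ l+1. Then the Hilbert symbol ((x−a)(x−b), (u−a')(u−b'))_{ℚ_p} is trivial; i.e., there exist r, s ∈ ℚ_p with (x−a)(x−b)·r² + (u−a')(u−b')·s² = 1. -/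

import Mathlib

/-- The Hilbert symbol `(A,B)_k` is trivial if `A·r² + B·s² = 1` is solvable. -/
def HilbertTrivial {k : Type*} [Field k] (A B : k) : Prop :=
  ∃ r s : k, A * r ^ 2 + B * s ^ 2 = 1

section Field

variable {k : Type*} [Field k]

theorem IsSquare.mul_of_mul_mul {m n c d : k} (hc : c ≠ 0) (hd : d ≠ 0)
    (hm : IsSquare (m * c)) (hn : IsSquare (n * d)) (hcd : IsSquare (c * d)) :
    IsSquare (m * n) := by
  have h : m * n = m * c * (n * d) / (c * d) := by field_simp
  exact h ▸ (hm.mul hn).div hcd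

theorem HilbertTrivial.symm {A B : k} (h : HilbertTrivial A B) : HilbertTrivial B A := by
  obtain ⟨r, s, h⟩ := h
  exact ⟨s, r, by rw [add_comm, h]⟩

theorem HilbertTrivial.of_isSquare_left {A : k} (B : k) (hA : A ≠ 0) (h : IsSquare A) :
    HilbertTrivial A B := by
  obtain ⟨r, rfl⟩ := h
  have hr : r ≠ 0 := by rintro rfl; simp at hA
  exact ⟨r⁻¹, 0, by field_simp; simp⟩

theorem HilbertTrivial.of_isSquare_right (A : k) {B : k} (hB : B ≠ 0) (h : IsSquare B) :
    HilbertTrivial A B :=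
  (HilbertTrivial.of_isSquare_left A hB h).symm

theorem HilbertTrivial.of_isSquare_neg_mul {A B : k} (h2 : (2 : k) ≠ 0) (hA : A ≠ 0)
    (hB : B ≠ 0) (h : IsSquare (-(A * B))) : HilbertTrivial A B := by
  obtain ⟨c, hc⟩ := h
  have hc0 : c ≠ 0 := by
    rintro rfl
    simp [hA, hB] at hc
  have hB' : B = -(c * c) / A := by rw [← hc]; field_simp
  refine ⟨(1 / A + 1) / 2, (1 / A - 1) / 2 * A / c, ?_⟩
  rw [hB']
  field_simp
  ring

end Field

namespace Padic

variable {p : ℕ} [Fact p.Prime]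

theorem isSquare_of_norm_sub_one_lt_one (hp : 2 < p) {t : ℚ_[p]} (ht : ‖t - 1‖ < 1) :
    IsSquare t := by
  have htn : ‖t‖ ≤ 1 := by
    have h := Padic.nonarchimedean (t - 1) 1
    rwa [sub_add_cancel, norm_one, max_eq_right ht.le] at h
  obtain ⟨t, rfl⟩ : ∃ t' : ℤ_[p], (t' : ℚ_[p]) = t := ⟨⟨t, htn⟩, rfl⟩
  have h2 : ‖(2 : ℤ_[p])‖ = 1 := by
    have h : ‖((2 : ℕ) : ℤ_[p])‖ = 1 :=
      PadicInt.norm_natCast_eq_one_iff.2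
        ((Nat.coprime_primes Fact.out Nat.prime_two).2 hp.ne')
    simpa using h
  have hlt : ‖1 - t‖ < 1 := by
    rw [norm_sub_rev]
    exact_mod_cast ht
  obtain ⟨s, hs, -⟩ := hensels_lemma (p := p) (R := ℤ_[p])
    (F := Polynomial.X ^ 2 - Polynomial.C t) (a := 1)
    (by simpa [one_add_one_eq_two, h2] using hlt)
  have hs' : s ^ 2 = t := by simpa [sub_eq_zero] using hs
  exact ⟨s, by rw [← hs']; push_cast; ring⟩

theorem isSquare_mul_of_norm_sub_lt (hp : 2 < p) {y c : ℚ_[p]} (h : ‖y - c‖ < ‖c‖) :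
    IsSquare (y * c) := by
  have hc : c ≠ 0 := norm_pos_iff.1 ((norm_nonneg _).trans_lt h)
  have hq : IsSquare (y / c) := by
    apply isSquare_of_norm_sub_one_lt_one hp
    rw [div_sub_one hc, norm_div]
    exact (div_lt_one (norm_pos_iff.2 hc)).2 h
  have hy : y * c = y / c * (c * c) := by field_simp
  exact hy ▸ hq.mul ⟨c, rfl⟩

theorem norm_lt_norm_of_valuation_lt {y c : ℚ_[p]} (hy : y ≠ 0) (hc : c ≠ 0)
    (h : c.valuation < y.valuation) : ‖y‖ < ‖c‖ := by
  rw [norm_eq_zpow_neg_valuation hy, norm_eq_zpow_neg_valuation hc]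
  exact zpow_lt_zpow_right₀ (by exact_mod_cast (Fact.out : p.Prime).one_lt) (by lia)

theorem isSquare_sub_mul_sub_of_norm_lt_left (hp : 2 < p) {x a b : ℚ_[p]} (ha : ‖a‖ < ‖x‖)
    (hb : ‖b‖ < ‖x‖) : IsSquare ((x - a) * (x - b)) := by
  have hx : x ≠ 0 := norm_pos_iff.1 ((norm_nonneg _).trans_lt ha)
  exact IsSquare.mul_of_mul_mul hx hx (isSquare_mul_of_norm_sub_lt hp (by simpa using ha))
    (isSquare_mul_of_norm_sub_lt hp (by simpa using hb)) ⟨x, rfl⟩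

theorem isSquare_sub_mul_sub_of_norm_lt_right (hp : 2 < p) {x a b : ℚ_[p]} (ha : ‖x‖ < ‖a‖)
    (hb : ‖x‖ < ‖b‖) (hab : IsSquare (a * b)) : IsSquare ((x - a) * (x - b)) := by
  have ha0 : a ≠ 0 := norm_pos_iff.1 ((norm_nonneg _).trans_lt ha)
  have hb0 : b ≠ 0 := norm_pos_iff.1 ((norm_nonneg _).trans_lt hb)
  exact IsSquare.mul_of_mul_mul (neg_ne_zero.2 ha0) (neg_ne_zero.2 hb0)
    (isSquare_mul_of_norm_sub_lt hp (by simpa using ha))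
    (isSquare_mul_of_norm_sub_lt hp (by simpa using hb)) (by simpa using hab)

end Padic

theorem stmt12 (p : ℕ) [Fact p.Prime] (hp : 2 < p) (a b a' b' : ℚ_[p])
    (ha : a ≠ 0) (hb : b ≠ 0) (ha' : a' ≠ 0) (hb' : b' ≠ 0)
    (haZ : 0 ≤ a.valuation) (hbZ : 0 ≤ b.valuation)
    (haZ' : 0 ≤ a'.valuation) (hbZ' : 0 ≤ b'.valuation)
    (hab : a ≠ b) (hab' : a' ≠ b')
    (hsq1 : IsSquare (a * b)) (hsq2 : IsSquare (a' * b')) (hsq3 : IsSquare (-(a * a')))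
    (l : ℤ)
    (hl : l = max (max (max a.valuation b.valuation) (a - b).valuation)
            (max (max a'.valuation b'.valuation) (a' - b').valuation))
    (x u z : ℚ_[p]) (hz : z ≠ 0)
    (heq : z ^ 2 = x * (x - a) * (x - b) * (u * (u - a') * (u - b')))
    (hT : x.valuation < 0 ∨ u.valuation < 0 ∨
      ∃ μ ∈ ({0, a, b} : Set ℚ_[p]), ∃ ν' ∈ ({0, a', b'} : Set ℚ_[p]),
        l + 1 ≤ (x - μ).valuation ∧ l + 1 ≤ (u - ν').valuation) :
    HilbertTrivial ((x - a) * (x - b)) ((u - a') * (u - b')) := by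
  have hne : x * (x - a) * (x - b) * (u * (u - a') * (u - b')) ≠ 0 := heq ▸ pow_ne_zero 2 hz
  simp only [mul_ne_zero_iff] at hne
  obtain ⟨⟨⟨hx, hxa⟩, hxb⟩, ⟨hu, hua⟩, hub⟩ := hne
  have hA := mul_ne_zero hxa hxb
  have hB := mul_ne_zero hua hub
  have hla : a.valuation ≤ l := by simp [hl]
  have hlb : b.valuation ≤ l := by simp [hl]
  have hla' : a'.valuation ≤ l := by simp [hl]
  have hlb' : b'.valuation ≤ l := by simp [hl]
  have lt {y c : ℚ_[p]} (hy : y ≠ 0) (hc : c ≠ 0) (h : c.valuation < y.valuation) : ‖y‖ < ‖c‖ :=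
    Padic.norm_lt_norm_of_valuation_lt hy hc h
  rcases hT with hT | hT | ⟨μ, hμ, ν, hν, hxμ, huν⟩
  · exact .of_isSquare_left _ hA (Padic.isSquare_sub_mul_sub_of_norm_lt_left hp
      (lt ha hx (by lia)) (lt hb hx (by lia)))
  · exact .of_isSquare_right _ hB (Padic.isSquare_sub_mul_sub_of_norm_lt_left hp
      (lt ha' hu (by lia)) (lt hb' hu (by lia)))
  by_cases hμ0 : μ = 0
  · rw [hμ0, sub_zero] at hxμ
    exact .of_isSquare_left _ hA (Padic.isSquare_sub_mul_sub_of_norm_lt_right hp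
      (lt hx ha (by lia)) (lt hx hb (by lia)) hsq1)
  by_cases hν0 : ν = 0
  · rw [hν0, sub_zero] at huν
    exact .of_isSquare_right _ hB (Padic.isSquare_sub_mul_sub_of_norm_lt_right hp
      (lt hu ha' (by lia)) (lt hu hb' (by lia)) hsq2)
  obtain ⟨hxμ0, hμl, hμa⟩ : x - μ ≠ 0 ∧ μ.valuation ≤ l ∧ IsSquare (μ * a) := by
    rcases hμ with rfl | rfl | rfl
    · contradiction
    · exact ⟨hxa, hla, μ, rfl⟩
    · exact ⟨hxb, hlb, mul_comm a μ ▸ hsq1⟩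
  obtain ⟨huν0, hνl, hνa⟩ : u - ν ≠ 0 ∧ ν.valuation ≤ l ∧ IsSquare (ν * a') := by
    rcases hν with rfl | rfl | rfl
    · contradiction
    · exact ⟨hua, hla', ν, rfl⟩
    · exact ⟨hub, hlb', mul_comm a' ν ▸ hsq2⟩
  have hxs : IsSquare (x * μ) :=
    Padic.isSquare_mul_of_norm_sub_lt hp (lt hxμ0 hμ0 (by lia))
  have hus : IsSquare (u * ν) :=
    Padic.isSquare_mul_of_norm_sub_lt hp (lt huν0 hν0 (by lia))
  have hμν : IsSquare (μ * -ν) :=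
    .mul_of_mul_mul ha (neg_ne_zero.2 ha') hμa (by simpa using hνa) (by simpa using hsq3)
  have hxu : IsSquare (x * -u) :=
    .mul_of_mul_mul hμ0 (neg_ne_zero.2 hν0) hxs (by simpa using hus) hμν
  refine .of_isSquare_neg_mul two_ne_zero hA hB ?_
  have h : -((x - a) * (x - b) * ((u - a') * (u - b'))) = z ^ 2 / (x * -u) := by
    rw [heq]
    field_simp
  exact h ▸ (IsSquare.sq z).div hxu
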